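/- arXiv:2109.05431 — 2 statements merged into one kernel-verified Lean document; each statement's English description precedes it below -/
import Mathlib

section
/- (Symmetry relation, equation (6) of the paper) Let σ = √(σ₁² - 2ρσ₁σ₂ + σ₂²) and ρ' = (σ₂ - ρσ₁)/σ (so |ρ'| < 1 since |ρ| < 1). Let X' = Z₂ and Y' = ρ'·Z₂ + √(1-ρ'²)·Z₁. Then for K > 0, E[(F₁·e^{-σ₁²T/2 + σ₁√T·Y} - F₂·e^{-σ₂²T/2 + σ₂√T·X} - K)⁺] = E[(F₁·e^{-σ²T/2 + σ√T·Y'} - K·e^{-σ₂²T/2 + σ₂√T·X'} - F₂)⁺]; that is, Π_T(F₁,σ₁,F₂,σ₂,K,ρ) = Π_T(F₁,σ,K,σ₂,F₂,(σ₂-ρσ₁)/σ). -/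
open MeasureTheory ProbabilityTheory Real

lemma lintegral_exp_mul_gaussianReal (a : ℝ) {g : ℝ → ENNReal} (hg : Measurable g) :
    ∫⁻ x, ENNReal.ofReal (exp (-a ^ 2 / 2 + a * x)) * g x ∂gaussianReal 0 1
      = ∫⁻ x, g (a - x) ∂gaussianReal 0 1 := by
  rw [gaussianReal_of_var_ne_zero 0 one_ne_zero,
    lintegral_withDensity_eq_lintegral_mul _ (measurable_gaussianPDF 0 1) (by fun_prop),
    lintegral_withDensity_eq_lintegral_mul _ (measurable_gaussianPDF 0 1) (by fun_prop),
    ← lintegral_sub_left_eq_self _ a]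
  refine lintegral_congr fun x => ?_
  simp only [Pi.mul_apply, ← mul_assoc]
  congr 1
  simp only [gaussianPDF]
  rw [← ENNReal.ofReal_mul (gaussianPDFReal_nonneg _ _ _)]
  simp only [gaussianPDFReal, mul_assoc, ← exp_add]
  congr 4
  simp only [NNReal.coe_one]
  ring

/-- Cameron–Martin shift in the second of two independent standard Gaussian variables, followed by
a reflection, for nonnegative integrands. -/
lemma integral_exp_mul_eq_integral_sub {Ω : Type*} [MeasurableSpace Ω] {P : Measure Ω}
    [IsProbabilityMeasure P] {Z₁ Z₂ : Ω → ℝ} (hmZ₁ : Measurable Z₁) (hmZ₂ : Measurable Z₂)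
    (hZ₂ : Measure.map Z₂ P = gaussianReal 0 1) (hindep : IndepFun Z₁ Z₂ P) (a : ℝ)
    {g : ℝ → ℝ → ℝ} (hg : Measurable (Function.uncurry g)) (hg₀ : ∀ z x, 0 ≤ g z x) :
    ∫ ω, exp (-a ^ 2 / 2 + a * Z₂ ω) * g (Z₁ ω) (Z₂ ω) ∂P
      = ∫ ω, g (Z₁ ω) (a - Z₂ ω) ∂P := by
  have hmap := (indepFun_iff_map_prod_eq_prod_map_map hmZ₁.aemeasurable hmZ₂.aemeasurable).1 hindep
  rw [hZ₂] at hmap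
  have : IsProbabilityMeasure (P.map Z₁) := Measure.isProbabilityMeasure_map hmZ₁.aemeasurable
  have key (h : ℝ × ℝ → ℝ) (hh : Measurable h) (hh₀ : ∀ p, 0 ≤ h p) :
      ∫ ω, h (Z₁ ω, Z₂ ω) ∂P
        = (∫⁻ z, ∫⁻ x, ENNReal.ofReal (h (z, x)) ∂gaussianReal 0 1 ∂P.map Z₁).toReal := by
    have hm := hmZ₁.prodMk hmZ₂
    rw [← integral_map (φ := fun ω => (Z₁ ω, Z₂ ω)) hm.aemeasurable hh.aestronglyMeasurable, hmap,
      integral_eq_lintegral_of_nonneg_ae (.of_forall hh₀) hh.aestronglyMeasurable,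
      lintegral_prod _ hh.ennreal_ofReal.aemeasurable]
  rw [key (fun p => exp (-a ^ 2 / 2 + a * p.2) * g p.1 p.2)
      (Measurable.mul (by fun_prop) hg) fun p => mul_nonneg (exp_pos _).le (hg₀ _ _),
    key (fun p => g p.1 (a - p.2))
      (hg.comp (measurable_fst.prodMk (measurable_snd.const_sub a))) fun p => hg₀ _ _]
  congr 1
  refine lintegral_congr fun z => ?_
  simp only [ENNReal.ofReal_mul (exp_pos _).le]
  exact lintegral_exp_mul_gaussianReal a
    (hg.comp (measurable_const.prodMk measurable_id)).ennreal_ofReal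

/-- (Symmetry relation, equation (6) of the paper) With `σ = √(σ₁² - 2ρσ₁σ₂ + σ₂²)` and
`ρ' = (σ₂ - ρσ₁)/σ`, letting `X' = Z₂` and `Y' = ρ'·Z₂ + √(1-ρ'²)·Z₁`, for `K > 0` one has
`Π_T(F₁,σ₁,F₂,σ₂,K,ρ) = Π_T(F₁,σ,K,σ₂,F₂,(σ₂-ρσ₁)/σ)`. -/
theorem spread_symmetry
    {Ω : Type*} [MeasurableSpace Ω] (P : Measure Ω) [IsProbabilityMeasure P]
    (Z₁ Z₂ : Ω → ℝ) (hmZ₁ : Measurable Z₁) (hmZ₂ : Measurable Z₂)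
    (hZ₁ : Measure.map Z₁ P = gaussianReal 0 1)
    (hZ₂ : Measure.map Z₂ P = gaussianReal 0 1)
    (hindep : IndepFun Z₁ Z₂ P)
    (ρ T σ₁ σ₂ F₁ F₂ K : ℝ)
    (hρ₁ : -1 < ρ) (hρ₂ : ρ < 1) (hT : 0 < T)
    (hσ₁ : 0 < σ₁) (hσ₂ : 0 < σ₂) (hF₁ : 0 < F₁) (hF₂ : 0 < F₂) (hK : 0 < K)
    (X Y : Ω → ℝ) (hX : X = Z₂)
    (hY : Y = fun ω => ρ * Z₂ ω + Real.sqrt (1 - ρ ^ 2) * Z₁ ω)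
    (σ ρ' : ℝ)
    (hσ : σ = Real.sqrt (σ₁ ^ 2 - 2 * ρ * σ₁ * σ₂ + σ₂ ^ 2))
    (hρ' : ρ' = (σ₂ - ρ * σ₁) / σ)
    (X' Y' : Ω → ℝ) (hX' : X' = Z₂)
    (hY' : Y' = fun ω => ρ' * Z₂ ω + Real.sqrt (1 - ρ' ^ 2) * Z₁ ω) :
    ∫ ω, max (F₁ * Real.exp (-(σ₁ ^ 2 * T) / 2 + σ₁ * Real.sqrt T * Y ω)
        - F₂ * Real.exp (-(σ₂ ^ 2 * T) / 2 + σ₂ * Real.sqrt T * X ω) - K) 0 ∂P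
      = ∫ ω, max (F₁ * Real.exp (-(σ ^ 2 * T) / 2 + σ * Real.sqrt T * Y' ω)
        - K * Real.exp (-(σ₂ ^ 2 * T) / 2 + σ₂ * Real.sqrt T * X' ω) - F₂) 0 ∂P := by
  rw [hX, hX', hY, hY']
  have hT' : √T ^ 2 = T := sq_sqrt hT.le
  have hρ : 0 < 1 - ρ ^ 2 := by nlinarith
  have hvar : 0 < σ₁ ^ 2 - 2 * ρ * σ₁ * σ₂ + σ₂ ^ 2 := by
    nlinarith [sq_nonneg (σ₂ - ρ * σ₁), mul_pos (pow_pos hσ₁ 2) hρ]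
  have hσpos : 0 < σ := hσ ▸ sqrt_pos.2 hvar
  have hσsq : σ ^ 2 = σ₁ ^ 2 - 2 * ρ * σ₁ * σ₂ + σ₂ ^ 2 := hσ ▸ sq_sqrt hvar.le
  have hσρ : σ * ρ' = σ₂ - ρ * σ₁ := by rw [hρ']; field_simp
  have hcorr : 0 ≤ 1 - ρ' ^ 2 := by
    rw [hρ', div_pow, sub_nonneg, div_le_one (by positivity), hσsq]
    nlinarith [mul_pos (pow_pos hσ₁ 2) hρ]
  have hsqrt : σ * √(1 - ρ' ^ 2) = σ₁ * √(1 - ρ ^ 2) := by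
    rw [← sq_eq_sq₀ (by positivity) (by positivity), mul_pow, mul_pow, sq_sqrt hρ.le, sq_sqrt hcorr]
    linear_combination hσsq - (σ * ρ' + (σ₂ - ρ * σ₁)) * hσρ
  have key := integral_exp_mul_eq_integral_sub hmZ₁ hmZ₂ hZ₂ hindep (σ₂ * √T)
    (g := fun z x => max (F₁ * exp (-(σ₁ ^ 2 * T) / 2 + σ₁ * √T * (ρ * x + √(1 - ρ ^ 2) * z)
        - (-(σ₂ ^ 2 * T) / 2 + σ₂ * √T * x)) - F₂
        - K * exp (-(-(σ₂ ^ 2 * T) / 2 + σ₂ * √T * x))) 0)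
    (by unfold Function.uncurry; fun_prop) fun _ _ => le_max_right _ _
  convert key using 1
  · refine integral_congr_ae (.of_forall fun ω => ?_)
    have hexp : -(σ₂ * √T) ^ 2 / 2 + σ₂ * √T * Z₂ ω
        = -(σ₂ ^ 2 * T) / 2 + σ₂ * √T * Z₂ ω := by
      rw [mul_pow, hT']
    simp only [hexp]
    rw [mul_max_of_nonneg _ _ (exp_pos _).le, mul_zero, exp_sub, exp_neg]
    congr 1
    generalize hE : exp (-(σ₂ ^ 2 * T) / 2 + σ₂ * √T * Z₂ ω) = E
    have hEne : E ≠ 0 := hE ▸ (exp_pos _).ne'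
    field_simp
  · refine integral_congr_ae (.of_forall fun ω => ?_)
    have h₁ : -(σ₁ ^ 2 * T) / 2
          + σ₁ * √T * (ρ * (σ₂ * √T - Z₂ ω) + √(1 - ρ ^ 2) * Z₁ ω)
          - (-(σ₂ ^ 2 * T) / 2 + σ₂ * √T * (σ₂ * √T - Z₂ ω))
        = -(σ ^ 2 * T) / 2 + σ * √T * (ρ' * Z₂ ω + √(1 - ρ' ^ 2) * Z₁ ω) := by
      linear_combination (σ₁ * σ₂ * ρ - σ₂ ^ 2) * hT' + T / 2 * hσsq
        - √T * Z₂ ω * hσρ - √T * Z₁ ω * hsqrt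
    have h₂ : -(-(σ₂ ^ 2 * T) / 2 + σ₂ * √T * (σ₂ * √T - Z₂ ω))
        = -(σ₂ ^ 2 * T) / 2 + σ₂ * √T * Z₂ ω := by
      linear_combination -σ₂ ^ 2 * hT'
    simp only [h₁, h₂]
    rw [sub_right_comm]
end

section
/- (Bjerksund–Stensland closed form, equations (25)–(27) of the paper) For a > 0, b ∈ ℝ and K > 0, e^{-rT}·E[ (S₁(T) - S₂(T) - K) · 1_{ S₁(T) ≥ a·exp(-b²σ₂²T/2 + bσ₂√T·X) } ] = e^{-rT}·[ F₁·Φ(d̄₁) - F₂·Φ(d̄₂) - K·Φ(d̄₃) ], where σ = √(σ₁² + b²σ₂² - 2ρbσ₁σ₂) (positive since |ρ| < 1), d̄₁ = ( ln(F₁/a) + (σ₁²/2 + b²σ₂²/2 - bρσ₁σ₂)T ) / (σ√T), d̄₂ = ( ln(F₁/a) + (-σ₁²/2 - bσ₂² + b²σ₂²/2 + ρσ₁σ₂)T ) / (σ√T), d̄₃ = ( ln(F₁/a) + (-σ₁²/2 + b²σ₂²/2)T ) / (σ√T). (Here a·exp(-b²σ₂²T/2 + bσ₂√T·X) = a·S₂(T)^b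 / E[S₂(T)^b].) -/
open MeasureTheory ProbabilityTheory Real

/-- The standard normal cumulative distribution function Φ. -/
noncomputable def stdGaussianCDF (x : ℝ) : ℝ := ((gaussianReal 0 1) (Set.Iic x)).toReal

lemma gaussianReal_one_eq_withDensity_exp (p : ℝ) :
    gaussianReal p 1 =
      (gaussianReal 0 1).withDensity fun x => ENNReal.ofReal (exp (p * x - p ^ 2 / 2)) := by
  rw [gaussianReal_of_var_ne_zero p one_ne_zero, gaussianReal_of_var_ne_zero 0 one_ne_zero,
    ← withDensity_mul _ (measurable_gaussianPDF 0 1) (by fun_prop)]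
  congr 1
  ext x
  simp only [Pi.mul_apply, gaussianPDF, ← ENNReal.ofReal_mul (gaussianPDFReal_nonneg _ _ _)]
  rw [gaussianPDFReal, gaussianPDFReal, mul_assoc _ (exp _) (exp _), ← exp_add]
  congr 3
  simp only [NNReal.coe_one]
  ring

lemma gaussianReal_Iic_toReal_eq_stdGaussianCDF (m c : ℝ) {s : ℝ} (hs : 0 < s) :
    (gaussianReal m (s ^ 2).toNNReal (Set.Iic c)).toReal = stdGaussianCDF ((c - m) / s) := by
  have hmap : gaussianReal m (s ^ 2).toNNReal =
      (gaussianReal 0 1).map (fun x => s * x + m) := by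
    have h : (fun x => s * x + m) = (fun y => y + m) ∘ fun x => s * x := rfl
    rw [h, ← Measure.map_map (by fun_prop) (by fun_prop), gaussianReal_map_const_mul,
      gaussianReal_map_add_const]
    congr 1
    · simp
    · ext
      simp [sq_nonneg]
  rw [hmap, Measure.map_apply (by fun_prop) measurableSet_Iic, stdGaussianCDF]
  congr 2
  ext x
  simp only [Set.mem_preimage, Set.mem_Iic]
  rw [le_div_iff₀ hs, le_sub_iff_add_le, mul_comm]

lemma map_linear_gaussianReal_prod (p q u v : ℝ) :
    ((gaussianReal p 1).prod (gaussianReal q 1)).map (fun z => u * z.1 + v * z.2) =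
      gaussianReal (u * p + v * q) (u ^ 2 + v ^ 2).toNNReal := by
  have hind : IndepFun (fun z : ℝ × ℝ => u * z.1) (fun z : ℝ × ℝ => v * z.2)
      ((gaussianReal p 1).prod (gaussianReal q 1)) :=
    indepFun_prod (X := fun x : ℝ => u * x) (Y := fun x : ℝ => v * x)
      (by fun_prop) (by fun_prop)
  have h₁ : ((gaussianReal p 1).prod (gaussianReal q 1)).map (fun z => u * z.1) =
      gaussianReal (u * p) (u ^ 2).toNNReal := by
    have h : (fun z : ℝ × ℝ => u * z.1) = (fun x => u * x) ∘ Prod.fst := rfl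
    rw [h, ← Measure.map_map (by fun_prop) measurable_fst, Measure.map_fst_prod]
    simp only [measure_univ, one_smul]
    rw [gaussianReal_map_const_mul, mul_one, toNNReal_of_nonneg (sq_nonneg u)]
  have h₂ : ((gaussianReal p 1).prod (gaussianReal q 1)).map (fun z => v * z.2) =
      gaussianReal (v * q) (v ^ 2).toNNReal := by
    have h : (fun z : ℝ × ℝ => v * z.2) = (fun x => v * x) ∘ Prod.snd := rfl
    rw [h, ← Measure.map_map (by fun_prop) measurable_snd, Measure.map_snd_prod]
    simp only [measure_univ, one_smul]
    rw [gaussianReal_map_const_mul, mul_one, toNNReal_of_nonneg (sq_nonneg v)]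
  have h := gaussianReal_add_gaussianReal_of_indepFun hind h₁ h₂
  rwa [← toNNReal_add (sq_nonneg u) (sq_nonneg v)] at h

/-- Exponential moment of a standard Gaussian vector restricted to a half-plane. -/
lemma setIntegral_exp_gaussianReal_prod (p q u v c : ℝ) (huv : 0 < u ^ 2 + v ^ 2) :
    ∫ z in {z : ℝ × ℝ | u * z.1 + v * z.2 ≤ c}, exp (p * z.1 + q * z.2)
        ∂((gaussianReal 0 1).prod (gaussianReal 0 1)) =
      exp ((p ^ 2 + q ^ 2) / 2) *
        stdGaussianCDF ((c - (u * p + v * q)) / √(u ^ 2 + v ^ 2)) := by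
  have hs : MeasurableSet {z : ℝ × ℝ | u * z.1 + v * z.2 ≤ c} :=
    measurableSet_le (by fun_prop) (by fun_prop)
  have hdens : (gaussianReal p 1).prod (gaussianReal q 1) =
      ((gaussianReal 0 1).prod (gaussianReal 0 1)).withDensity fun z =>
        ENNReal.ofReal (exp (p * z.1 - p ^ 2 / 2)) *
          ENNReal.ofReal (exp (q * z.2 - q ^ 2 / 2)) := by
    rw [gaussianReal_one_eq_withDensity_exp p, gaussianReal_one_eq_withDensity_exp q,
      prod_withDensity (by fun_prop) (by fun_prop)]
  have hlaw : (((gaussianReal p 1).prod (gaussianReal q 1))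
      {z : ℝ × ℝ | u * z.1 + v * z.2 ≤ c}).toReal =
        stdGaussianCDF ((c - (u * p + v * q)) / √(u ^ 2 + v ^ 2)) := by
    rw [← gaussianReal_Iic_toReal_eq_stdGaussianCDF _ _ (sqrt_pos.2 huv), sq_sqrt huv.le,
      ← map_linear_gaussianReal_prod, Measure.map_apply (by fun_prop) measurableSet_Iic]
    rfl
  rw [← hlaw, hdens, withDensity_apply _ hs,
    integral_eq_lintegral_of_nonneg_ae (ae_of_all _ fun _ => (exp_pos _).le) (by fun_prop),
    ← ENNReal.toReal_ofReal (exp_pos ((p ^ 2 + q ^ 2) / 2)).le, ← ENNReal.toReal_mul,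
    ← lintegral_const_mul _ (by fun_prop)]
  congr 2
  ext z
  rw [← ENNReal.ofReal_mul (exp_pos _).le, ← ENNReal.ofReal_mul (exp_pos _).le, ← exp_add,
    ← exp_add]
  congr 2
  ring

lemma integrable_exp_gaussianReal_prod (p q : ℝ) :
    Integrable (fun z : ℝ × ℝ => exp (p * z.1 + q * z.2))
      ((gaussianReal 0 1).prod (gaussianReal 0 1)) := by
  simp_rw [exp_add]
  exact (integrable_exp_mul_gaussianReal p).mul_prod (integrable_exp_mul_gaussianReal q)

section HalfPlane

variable {Ω : Type*} [MeasurableSpace Ω] {P : Measure Ω} [IsProbabilityMeasure P]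
  {Z₁ Z₂ : Ω → ℝ}

lemma map_prodMk_stdGaussian (hmZ₁ : Measurable Z₁) (hmZ₂ : Measurable Z₂)
    (hZ₁ : P.map Z₁ = gaussianReal 0 1) (hZ₂ : P.map Z₂ = gaussianReal 0 1)
    (hindep : IndepFun Z₁ Z₂ P) :
    P.map (fun ω => (Z₁ ω, Z₂ ω)) = (gaussianReal 0 1).prod (gaussianReal 0 1) := by
  rw [(indepFun_iff_map_prod_eq_prod_map_map hmZ₁.aemeasurable hmZ₂.aemeasurable).1 hindep,
    hZ₁, hZ₂]

lemma integrable_exp_of_indep_stdGaussian (hmZ₁ : Measurable Z₁) (hmZ₂ : Measurable Z₂)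
    (hZ₁ : P.map Z₁ = gaussianReal 0 1) (hZ₂ : P.map Z₂ = gaussianReal 0 1)
    (hindep : IndepFun Z₁ Z₂ P) (p q : ℝ) :
    Integrable (fun ω => exp (p * Z₁ ω + q * Z₂ ω)) P := by
  have h := integrable_exp_gaussianReal_prod p q
  rw [← map_prodMk_stdGaussian hmZ₁ hmZ₂ hZ₁ hZ₂ hindep] at h
  exact h.comp_measurable (hmZ₁.prodMk hmZ₂)

lemma setIntegral_exp_of_indep_stdGaussian (hmZ₁ : Measurable Z₁) (hmZ₂ : Measurable Z₂)
    (hZ₁ : P.map Z₁ = gaussianReal 0 1) (hZ₂ : P.map Z₂ = gaussianReal 0 1)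
    (hindep : IndepFun Z₁ Z₂ P) (p q u v c : ℝ) (huv : 0 < u ^ 2 + v ^ 2) :
    ∫ ω in {ω | u * Z₁ ω + v * Z₂ ω ≤ c}, exp (p * Z₁ ω + q * Z₂ ω) ∂P =
      exp ((p ^ 2 + q ^ 2) / 2) *
        stdGaussianCDF ((c - (u * p + v * q)) / √(u ^ 2 + v ^ 2)) := by
  rw [← setIntegral_exp_gaussianReal_prod p q u v c huv,
    ← map_prodMk_stdGaussian hmZ₁ hmZ₂ hZ₁ hZ₂ hindep,
    setIntegral_map (measurableSet_le (by fun_prop) (by fun_prop)) (by fun_prop)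
      (hmZ₁.prodMk hmZ₂).aemeasurable]
  rfl

end HalfPlane

/-- (Bjerksund–Stensland closed form, equations (25)–(27) of the paper) For `a > 0`,
`b ∈ ℝ`, `K > 0`,
`e^{-rT}·E[(S₁(T) - S₂(T) - K)·1_{S₁(T) ≥ a·exp(-b²σ₂²T/2 + bσ₂√T·X)}]
  = e^{-rT}·[F₁Φ(d̄₁) - F₂Φ(d̄₂) - KΦ(d̄₃)]`. -/
theorem bjerksund_stensland_closed_form
    {Ω : Type*} [MeasurableSpace Ω] (P : Measure Ω) [IsProbabilityMeasure P]
    (Z₁ Z₂ : Ω → ℝ) (hmZ₁ : Measurable Z₁) (hmZ₂ : Measurable Z₂)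
    (hZ₁ : Measure.map Z₁ P = gaussianReal 0 1)
    (hZ₂ : Measure.map Z₂ P = gaussianReal 0 1)
    (hindep : IndepFun Z₁ Z₂ P)
    (ρ r T σ₁ σ₂ F₁ F₂ K : ℝ)
    (hρ₁ : -1 < ρ) (hρ₂ : ρ < 1) (hT : 0 < T)
    (hσ₁ : 0 < σ₁) (hσ₂ : 0 < σ₂) (hF₁ : 0 < F₁) (hF₂ : 0 < F₂) (hK : 0 < K)
    (X Y : Ω → ℝ) (hX : X = Z₂)
    (hY : Y = fun ω => ρ * Z₂ ω + Real.sqrt (1 - ρ ^ 2) * Z₁ ω)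
    (S₁ S₂ : Ω → ℝ)
    (hS₁ : S₁ = fun ω => F₁ * Real.exp (-(σ₁ ^ 2 * T) / 2 + σ₁ * Real.sqrt T * Y ω))
    (hS₂ : S₂ = fun ω => F₂ * Real.exp (-(σ₂ ^ 2 * T) / 2 + σ₂ * Real.sqrt T * X ω))
    (a b : ℝ) (ha : 0 < a)
    (σ : ℝ) (hσ : σ = Real.sqrt (σ₁ ^ 2 + b ^ 2 * σ₂ ^ 2 - 2 * ρ * b * σ₁ * σ₂))
    (d₁ d₂ d₃ : ℝ)
    (hd₁ : d₁ = (Real.log (F₁ / a)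
      + (σ₁ ^ 2 / 2 + b ^ 2 * σ₂ ^ 2 / 2 - b * ρ * σ₁ * σ₂) * T) / (σ * Real.sqrt T))
    (hd₂ : d₂ = (Real.log (F₁ / a)
      + (-σ₁ ^ 2 / 2 - b * σ₂ ^ 2 + b ^ 2 * σ₂ ^ 2 / 2 + ρ * σ₁ * σ₂) * T) / (σ * Real.sqrt T))
    (hd₃ : d₃ = (Real.log (F₁ / a)
      + (-σ₁ ^ 2 / 2 + b ^ 2 * σ₂ ^ 2 / 2) * T) / (σ * Real.sqrt T)) :
    Real.exp (-(r * T)) *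
      ∫ ω in {ω | a * Real.exp (-(b ^ 2 * σ₂ ^ 2 * T) / 2 + b * σ₂ * Real.sqrt T * X ω) ≤ S₁ ω},
        (S₁ ω - S₂ ω - K) ∂P
      = Real.exp (-(r * T)) *
        (F₁ * stdGaussianCDF d₁ - F₂ * stdGaussianCDF d₂ - K * stdGaussianCDF d₃) := by
  subst hX hY hS₁ hS₂
  have hρ : 0 < 1 - ρ ^ 2 := by nlinarith
  set R := √(1 - ρ ^ 2) with hR
  have hR2 : R ^ 2 = 1 - ρ ^ 2 := sq_sqrt hρ.le
  set t := √T with ht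
  have ht2 : t ^ 2 = T := sq_sqrt hT.le
  have ht0 : 0 < t := sqrt_pos.2 hT
  set u := -(σ₁ * t * R) with hu
  set v := b * σ₂ * t - σ₁ * t * ρ with hv
  set c := log (F₁ / a) + (-σ₁ ^ 2 / 2 + b ^ 2 * σ₂ ^ 2 / 2) * T with hc
  have huvT : u ^ 2 + v ^ 2 =
      (σ₁ ^ 2 + b ^ 2 * σ₂ ^ 2 - 2 * ρ * b * σ₁ * σ₂) * T := by
    rw [hu, hv, ← ht2]
    linear_combination σ₁ ^ 2 * t ^ 2 * hR2
  have huv : 0 < u ^ 2 + v ^ 2 := by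
    have hu0 : u ≠ 0 := neg_ne_zero.2 (mul_pos (mul_pos hσ₁ ht0) (sqrt_pos.2 hρ)).ne'
    positivity
  have hsqrt : √(u ^ 2 + v ^ 2) = σ * t := by
    rw [huvT, sqrt_mul' _ hT.le, ← hσ]
  have hset : {ω | a * exp (-(b ^ 2 * σ₂ ^ 2 * T) / 2 + b * σ₂ * t * X ω) ≤
        F₁ * exp (-(σ₁ ^ 2 * T) / 2 + σ₁ * t * (ρ * X ω + R * Z₁ ω))} =
      {ω | u * Z₁ ω + v * X ω ≤ c} := by
    ext ω
    simp only [Set.mem_ofPred_eq]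
    rw [← log_le_log_iff (by positivity) (by positivity), log_mul ha.ne' (exp_pos _).ne',
      log_mul hF₁.ne' (exp_pos _).ne', log_exp, log_exp, hc, log_div hF₁.ne' ha.ne', hu, hv]
    constructor <;> intro h <;> linarith
  have hexp := integrable_exp_of_indep_stdGaussian hmZ₁ hmZ₂ hZ₁ hZ₂ hindep
  have hval := fun p q =>
    setIntegral_exp_of_indep_stdGaussian hmZ₁ hmZ₂ hZ₁ hZ₂ hindep p q u v c huv
  have hpay : ∀ ω, F₁ * exp (-(σ₁ ^ 2 * T) / 2 + σ₁ * t * (ρ * X ω + R * Z₁ ω)) -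
        F₂ * exp (-(σ₂ ^ 2 * T) / 2 + σ₂ * t * X ω) - K =
      F₁ * exp (-(σ₁ ^ 2 * T) / 2) * exp (σ₁ * t * R * Z₁ ω + σ₁ * t * ρ * X ω) -
        F₂ * exp (-(σ₂ ^ 2 * T) / 2) * exp (0 * Z₁ ω + σ₂ * t * X ω) -
        K * exp (0 * Z₁ ω + 0 * X ω) := by
    intro ω
    rw [exp_add, exp_add, mul_assoc F₁, mul_assoc F₂]
    ring_nf
    simp
  rw [hset]
  simp_rw [hpay]
  rw [integral_sub ((((hexp _ _).const_mul _).sub' ((hexp _ _).const_mul _)).integrableOn)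
      ((hexp _ _).const_mul _).integrableOn,
    integral_sub ((hexp _ _).const_mul _).integrableOn ((hexp _ _).const_mul _).integrableOn,
    integral_const_mul, integral_const_mul, integral_const_mul, hval, hval, hval, hsqrt]
  have he₁ : exp (-(σ₁ ^ 2 * T) / 2) * exp (((σ₁ * t * R) ^ 2 + (σ₁ * t * ρ) ^ 2) / 2) = 1 := by
    rw [← exp_add, exp_eq_one_iff, ← ht2]
    linear_combination σ₁ ^ 2 * t ^ 2 / 2 * hR2
  have he₂ : exp (-(σ₂ ^ 2 * T) / 2) * exp ((0 ^ 2 + (σ₂ * t) ^ 2) / 2) = 1 := by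
    rw [← exp_add, exp_eq_one_iff, ← ht2]
    ring
  have he₃ : exp (((0 : ℝ) ^ 2 + 0 ^ 2) / 2) = 1 := by simp
  have hd₁' : (c - (u * (σ₁ * t * R) + v * (σ₁ * t * ρ))) / (σ * t) = d₁ := by
    rw [hd₁, hc, hu, hv, ← ht2]
    congr 1
    linear_combination σ₁ ^ 2 * t ^ 2 * hR2
  have hd₂' : (c - (u * 0 + v * (σ₂ * t))) / (σ * t) = d₂ := by
    rw [hd₂, hc, hv, ← ht2]
    congr 1
    ring
  have hd₃' : (c - (u * 0 + v * 0)) / (σ * t) = d₃ := by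
    rw [hd₃, hc]
    congr 1
    ring
  rw [hd₁', hd₂', hd₃', he₃]
  linear_combination exp (-(r * T)) *
    (F₁ * stdGaussianCDF d₁ * he₁ - F₂ * stdGaussianCDF d₂ * he₂)
end
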